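/- The elements x_h for h = 1, 2, …, a(b+1)−1, where x_h := Σ v_{(i_0,0)} ∧ v_{(i_1,1)} ∧ ⋯ ∧ v_{(i_{b−1},b−1)} ⊗ g_{h−i_0−⋯−i_{b−1}} (the sum over all tuples (i_0,…,i_{b−1}) ∈ {0,…,a}^b with 1 ≤ h − (i_0+⋯+i_{b−1}) ≤ a−1), form a basis of the kernel of the map f. In particular dim_k ker f = a(b+1) − 1. -/

import Mathlib

open scoped TensorProduct

set_option maxHeartbeats 1600000
set_option synthInstance.maxHeartbeats 400000
set_option maxSynthPendingDepth 3

noncomputable section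

/-- The basis vector `g_h` of a vector space `G_m` with basis `g_1, …, g_m`;
by convention `g_h = 0` when `h` is out of range. -/
def gG (k : Type*) [Field k] (m : ℕ) (h : ℤ) : Fin m → k :=
  if H : 1 ≤ h ∧ h ≤ m then Pi.single (⟨(h - 1).toNat, by omega⟩ : Fin m) 1 else 0

/-- The basis vector `v'_P` of `V_B`, for `P` a point of `A = {0,…,a}×{0,…,b−1}`;
it is zero when `P ∉ B = {0,…,a−1}×{0,…,b−1}`. -/
def vB (k : Type*) [Field k] (a b : ℕ) (P : Fin (a + 1) × Fin b) : Fin a × Fin b → k :=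
  if h : (P.1 : ℕ) < a then Pi.single ((⟨P.1, h⟩ : Fin a), P.2) 1 else 0

/-- The basis vector `v'_{P−(1,0)}` of `V_B`, for `P` a point of `A`;
it is zero when `P − (1,0) ∉ B`. -/
def vBshift (k : Type*) [Field k] (a b : ℕ) (P : Fin (a + 1) × Fin b) : Fin a × Fin b → k :=
  if h : 1 ≤ (P.1 : ℕ) then
    Pi.single ((⟨(P.1 : ℕ) - 1, by have := P.1.isLt; omega⟩ : Fin a), P.2) 1 else 0

/-- The increasing enumeration `Fin (m−1) → Fin m` of `{0,…,m−1} \ {l}`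
(the `l`-th basis vector is omitted from a wedge product). -/
def skipAt {m : ℕ} (l : Fin m) (t : Fin (m - 1)) : Fin m :=
  ⟨if (t : ℕ) < (l : ℕ) then (t : ℕ) else (t : ℕ) + 1, by
    have := t.2; have := l.2; split <;> omega⟩

/-- The wedge product of a family of vectors, as an element of the `n`-th exterior power. -/
def wedge (k : Type*) [Field k] {M : Type*} [AddCommGroup M] [Module k M] (n : ℕ)
    (v : Fin n → M) : ⋀[k]^n M :=
  ⟨ExteriorAlgebra.ιMulti k n v, ExteriorAlgebra.ιMulti_range k n (Set.mem_range_self v)⟩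

/-- The defining property of the linear map
`f : Λ^b V_A ⊗ G_{a−1} → Λ^{b−1} V_A ⊗ V_B ⊗ G_{a−2}`:
`f(v_{P_1}∧⋯∧v_{P_b} ⊗ g_h) = Σ_{l=1}^b (−1)^l v_{P_1}∧⋯∧v̂_{P_l}∧⋯∧v_{P_b} ⊗ v'_{P_l} ⊗ g_{h−1}
  − Σ_{l=1}^b (−1)^l v_{P_1}∧⋯∧v̂_{P_l}∧⋯∧v_{P_b} ⊗ v'_{P_l−(1,0)} ⊗ g_h`,
with out-of-range basis symbols interpreted as `0`. -/
def IsTheMapF (k : Type*) [Field k] (a b : ℕ)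
    (f : ((⋀[k]^b ((Fin (a + 1) × Fin b) → k)) ⊗[k] (Fin (a - 1) → k)) →ₗ[k]
      (((⋀[k]^(b - 1) ((Fin (a + 1) × Fin b) → k)) ⊗[k] (Fin a × Fin b → k)) ⊗[k]
        (Fin (a - 2) → k))) : Prop :=
  ∀ (P : Fin b → Fin (a + 1) × Fin b) (h : ℤ),
    f (wedge k b (fun l => Pi.single (P l) 1) ⊗ₜ[k] gG k (a - 1) h) =
      ∑ l : Fin b, ((-1 : k) ^ ((l : ℕ) + 1)) •
        (((wedge k (b - 1) (fun t => Pi.single (P (skipAt l t)) 1) ⊗ₜ[k] vB k a b (P l))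
            ⊗ₜ[k] gG k (a - 2) (h - 1))
          - ((wedge k (b - 1) (fun t => Pi.single (P (skipAt l t)) 1) ⊗ₜ[k] vBshift k a b (P l))
            ⊗ₜ[k] gG k (a - 2) h))

/-- The element
`x_h = Σ v_{(i_0,0)} ∧ ⋯ ∧ v_{(i_{b−1},b−1)} ⊗ g_{h−i_0−⋯−i_{b−1}}` of `Λ^b V_A ⊗ G_{a−1}`,
the sum being over all tuples `(i_0,…,i_{b−1}) ∈ {0,…,a}^b` with
`1 ≤ h − (i_0+⋯+i_{b−1}) ≤ a−1` (this constraint is imposed by the convention `g_j = 0`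
for `j` out of range). -/
def xker (k : Type*) [Field k] (a b : ℕ) (h : ℤ) :
    (⋀[k]^b ((Fin (a + 1) × Fin b) → k)) ⊗[k] (Fin (a - 1) → k) :=
  ∑ i : Fin b → Fin (a + 1),
    wedge k b (fun l => Pi.single (i l, l) 1) ⊗ₜ[k] gG k (a - 1) (h - ∑ l : Fin b, (i l : ℤ))

section Coefficients

variable {k : Type*} [Field k] {ι : Type*}

/-- The coefficient of `g_h` in a vector of `G_m`, zero when `h` is out of range. -/
def gCoord (k : Type*) [Field k] (m : ℕ) (h : ℤ) : (Fin m → k) →ₗ[k] k :=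
  if H : 1 ≤ h ∧ h ≤ m then LinearMap.proj (⟨(h - 1).toNat, by omega⟩ : Fin m) else 0

theorem gCoord_gG (m : ℕ) (h h' : ℤ) :
    gCoord k m h (gG k m h') = if h = h' ∧ 1 ≤ h ∧ h ≤ m then 1 else 0 := by
  unfold gCoord gG
  by_cases H : 1 ≤ h ∧ h ≤ m <;> by_cases H' : 1 ≤ h' ∧ h' ≤ m
  · simp only [H, H', and_self, dite_true, LinearMap.proj_apply, Pi.single_apply, Fin.mk.injEq,
      and_true]
    congr 1
    simp only [eq_iff_iff]
    omega
  · have : h ≠ h' := fun e => H' (e ▸ H)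
    simp [H, H', this]
  · simp [H]
  · simp [H]

theorem gG_val_add_one {m : ℕ} (j : Fin m) : gG k m ((j : ℤ) + 1) = Pi.single j 1 := by
  unfold gG
  rw [dif_pos (by omega)]
  congr 1
  ext
  simp

theorem gCoord_val_add_one {m : ℕ} (j : Fin m) : gCoord k m ((j : ℤ) + 1) = LinearMap.proj j := by
  unfold gCoord
  rw [dif_pos (by omega)]
  congr 1
  ext
  simp

/-- The linear form on `Λ^n (ι → k)` dual to `e_{P 0} ∧ ⋯ ∧ e_{P (n-1)}`. -/
def wedgeCoord (k : Type*) [Field k] {ι : Type*} {n : ℕ} (P : Fin n → ι) :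
    ⋀[k]^n (ι → k) →ₗ[k] k :=
  exteriorPower.alternatingMapToDual k (ι → k) n (fun j => LinearMap.proj (P j))

theorem wedgeCoord_wedge [DecidableEq ι] {n : ℕ} (P Q : Fin n → ι) :
    wedgeCoord k P (wedge k n (fun l => Pi.single (Q l) 1)) =
      (Matrix.of fun i j => if P j = Q i then (1 : k) else 0).det := by
  refine (exteriorPower.alternatingMapToDual_apply_ιMulti _ _).trans ?_
  simp [Pi.single_apply]

theorem wedgeCoord_comp_perm {n : ℕ} (P : Fin n → ι) (σ : Equiv.Perm (Fin n)) :
    wedgeCoord k (P ∘ σ) = (Equiv.Perm.sign σ : ℤ) • wedgeCoord k P :=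
  (exteriorPower.alternatingMapToDual k (ι → k) n).map_perm (fun j => LinearMap.proj (P j)) σ

theorem wedgeCoord_eq_zero {n : ℕ} (P : Fin n → ι) {p q : Fin n} (hpq : p ≠ q) (h : P p = P q) :
    wedgeCoord k P = 0 :=
  (exteriorPower.alternatingMapToDual k (ι → k) n).map_eq_zero_of_eq
    (fun j => LinearMap.proj (P j)) (by simp only [h]) hpq

/-- The coefficient of `e_{P 0} ∧ ⋯ ∧ e_{P (n-1)} ⊗ g_h` in an element of `Λ^n (ι → k) ⊗ G_m`. -/
def wedgeGCoeff (k : Type*) [Field k] {ι : Type*} {n : ℕ} (m : ℕ) (P : Fin n → ι) (h : ℤ) :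
    (⋀[k]^n (ι → k)) ⊗[k] (Fin m → k) →ₗ[k] k :=
  LinearMap.mul' k k ∘ₗ TensorProduct.map (wedgeCoord k P) (gCoord k m h)

theorem wedgeGCoeff_tmul {n m : ℕ} (P : Fin n → ι) (h : ℤ) (w : ⋀[k]^n (ι → k)) (g : Fin m → k) :
    wedgeGCoeff k m P h (w ⊗ₜ g) = wedgeCoord k P w * gCoord k m h g := rfl

theorem wedgeGCoeff_comp_perm {n m : ℕ} (P : Fin n → ι) (σ : Equiv.Perm (Fin n)) (h : ℤ)
    (x : (⋀[k]^n (ι → k)) ⊗[k] (Fin m → k)) :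
    wedgeGCoeff k m (P ∘ σ) h x = (Equiv.Perm.sign σ : ℤ) • wedgeGCoeff k m P h x := by
  suffices H : wedgeGCoeff k m (P ∘ σ) h = (Equiv.Perm.sign σ : ℤ) • wedgeGCoeff k m P h by
    rw [H]; rfl
  refine TensorProduct.ext' fun w g => ?_
  simp only [wedgeGCoeff_tmul, wedgeCoord_comp_perm, LinearMap.smul_apply, smul_mul_assoc]

theorem wedgeGCoeff_eq_zero {n m : ℕ} (P : Fin n → ι) {p q : Fin n} (hpq : p ≠ q) (h : P p = P q)
    (d : ℤ) : wedgeGCoeff k m P d = 0 := by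
  refine TensorProduct.ext' fun w g => ?_
  simp [wedgeGCoeff_tmul, wedgeCoord_eq_zero P hpq h]

theorem ext_wedgeGCoeff [Finite ι] {n m : ℕ} {x y : (⋀[k]^n (ι → k)) ⊗[k] (Fin m → k)}
    (H : ∀ (P : Fin n → ι) (h : ℤ), 1 ≤ h → h ≤ m →
      wedgeGCoeff k m P h x = wedgeGCoeff k m P h y) : x = y := by
  classical
  let : LinearOrder ι := linearOrderOfSTO WellOrderingRel
  let B := ((Pi.basisFun k ι).exteriorPower n).tensorProduct (Pi.basisFun k (Fin m))
  refine B.ext_elem fun ⟨s, j⟩ => ?_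
  have key : B.coord (s, j) =
      wedgeGCoeff k m (Set.powersetCard.ofFinEmbEquiv.symm s) ((j : ℤ) + 1) := by
    refine TensorProduct.ext' fun w g => ?_
    rw [wedgeGCoeff_tmul, gCoord_val_add_one, Module.Basis.coord_apply,
      Module.Basis.tensorProduct_repr_tmul_apply, exteriorPower.basis_repr_apply, mul_comm]
    have hs : exteriorPower.ιMultiDual k n (Pi.basisFun k ι) s =
        wedgeCoord k (Set.powersetCard.ofFinEmbEquiv.symm s) := by
      refine exteriorPower.linearMap_ext (AlternatingMap.ext fun v => ?_)
      refine (exteriorPower.ιMultiDual_apply_ιMulti k n _ s v).trans ?_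
      refine Eq.trans ?_ (exteriorPower.alternatingMapToDual_apply_ιMulti _ v).symm
      simp
    rw [hs]
    simp
  have := H (Set.powersetCard.ofFinEmbEquiv.symm s) ((j : ℤ) + 1) (by omega) (by omega)
  rw [← key] at this
  exact this

theorem linearMap_ext_wedge_tmul_gG [Finite ι] [DecidableEq ι] {n m : ℕ} {N : Type*}
    [AddCommGroup N] [Module k N] {f g : (⋀[k]^n (ι → k)) ⊗[k] (Fin m → k) →ₗ[k] N}
    (H : ∀ (P : Fin n → ι) (h : ℤ), f (wedge k n (fun l => Pi.single (P l) 1) ⊗ₜ gG k m h) =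
      g (wedge k n (fun l => Pi.single (P l) 1) ⊗ₜ gG k m h)) : f = g := by
  classical
  let : LinearOrder ι := linearOrderOfSTO WellOrderingRel
  let B := ((Pi.basisFun k ι).exteriorPower n).tensorProduct (Pi.basisFun k (Fin m))
  refine B.ext fun ⟨s, j⟩ => ?_
  have key : B (s, j) = wedge k n (fun l =>
      Pi.single (Set.powersetCard.ofFinEmbEquiv.symm s l) 1) ⊗ₜ gG k m ((j : ℤ) + 1) := by
    rw [gG_val_add_one, Module.Basis.tensorProduct_apply, exteriorPower.basis_apply,
      Pi.basisFun_apply]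
    congr 1
    refine Subtype.ext ?_
    simp [exteriorPower.ιMulti_family, wedge, Function.comp_def]
  rw [key]
  convert H (Set.powersetCard.ofFinEmbEquiv.symm s) ((j : ℤ) + 1)

end Coefficients

section Tuples

theorem exists_sum_val_eq (a n s : ℕ) (hs : s ≤ a * n) :
    ∃ i : Fin n → Fin (a + 1), ∑ l, (i l : ℤ) = s := by
  induction n generalizing s with
  | zero => exact ⟨Fin.elim0, by simp at hs; simp [hs]⟩
  | succ n ih =>
    obtain ⟨i, hi⟩ := ih (s - min s a) (by rw [mul_add] at hs; omega)
    refine ⟨Fin.cons ⟨min s a, by omega⟩ i, ?_⟩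
    simp only [Fin.sum_univ_succ, Fin.cons_zero, Fin.cons_succ, hi]
    omega

/-- A function of `i ∈ {0,…,a}^n` and `h ∈ {1,…,a-1}` which does not change when a unit is moved
between `h` and an entry of `i`. -/
def IsHankel {k : Type*} (a : ℕ) {n : ℕ} (F : (Fin n → Fin (a + 1)) → ℤ → k) : Prop :=
  ∀ (i i' : Fin n → Fin (a + 1)) (l : Fin n) (m : ℤ), (∀ j, j ≠ l → i' j = i j) →
    (i' l : ℕ) = i l + 1 → 1 ≤ m → m + 2 ≤ a → F i (m + 1) = F i' m

theorem sum_val_of_eq_off {a n : ℕ} {i i' : Fin n → Fin (a + 1)} {l : Fin n}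
    (h : ∀ j, j ≠ l → i' j = i j) :
    ∑ j, (i' j : ℤ) = ∑ j, (i j : ℤ) + ((i' l : ℤ) - i l) := by
  rw [← Finset.add_sum_erase _ _ (Finset.mem_univ l),
    ← Finset.add_sum_erase _ (fun j => (i j : ℤ)) (Finset.mem_univ l),
    Finset.sum_congr rfl fun j hj => by rw [h j (Finset.ne_of_mem_erase hj)]]
  ring

theorem sum_natAbs_lt_of_eq_off {a n : ℕ} {i i' i'' : Fin n → Fin (a + 1)} {l : Fin n}
    (h : ∀ j, j ≠ l → i' j = i j)
    (hl : ((i' l : ℤ) - i'' l).natAbs < ((i l : ℤ) - i'' l).natAbs) :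
    ∑ j, ((i' j : ℤ) - i'' j).natAbs < ∑ j, ((i j : ℤ) - i'' j).natAbs := by
  refine Finset.sum_lt_sum (fun j _ => ?_) ⟨l, Finset.mem_univ l, hl⟩
  by_cases hj : j = l
  · subst hj; exact hl.le
  · rw [h j hj]

/-- A Hankel function depends only on `i_1 + ⋯ + i_n + h`. -/
theorem IsHankel.eq_of_sum_eq {k : Type*} {a n : ℕ} {F : (Fin n → Fin (a + 1)) → ℤ → k}
    (hF : IsHankel a F) (ha : 3 ≤ a) {i i' : Fin n → Fin (a + 1)} {h h' : ℤ}
    (h1 : 1 ≤ h) (h2 : h + 1 ≤ a) (h1' : 1 ≤ h') (h2' : h' + 1 ≤ a)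
    (hs : ∑ l, (i l : ℤ) + h = ∑ l, (i' l : ℤ) + h') : F i h = F i' h' := by
  induction hd : ∑ j, ((i j : ℤ) - i' j).natAbs using Nat.strong_induction_on
    generalizing i h with
  | _ d ih =>
    subst hd
    by_cases hup : (∃ l, (i l : ℕ) < i' l) ∧ 2 ≤ h
    · obtain ⟨⟨l, hl⟩, hh⟩ := hup
      have hlt : (i l : ℕ) + 1 < a + 1 := by have := (i' l).2; omega
      let j := Function.update i l ⟨i l + 1, hlt⟩
      have hj : ∀ p, p ≠ l → j p = i p := fun p hp => Function.update_of_ne hp _ _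
      have hjl : (j l : ℕ) = i l + 1 := by simp [j]
      have hsum := sum_val_of_eq_off hj
      have hstep := hF i j l (h - 1) hj hjl (by omega) (by omega)
      rw [sub_add_cancel] at hstep
      rw [hstep]
      exact ih _ (sum_natAbs_lt_of_eq_off hj (by omega)) (by omega) (by omega) (by omega) rfl
    by_cases hdown : (∃ l, (i' l : ℕ) < i l) ∧ h + 2 ≤ a
    · obtain ⟨⟨l, hl⟩, hh⟩ := hdown
      have hlt : (i l : ℕ) - 1 < a + 1 := by have := (i l).2; omega
      let j := Function.update i l ⟨i l - 1, hlt⟩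
      have hj : ∀ p, p ≠ l → j p = i p := fun p hp => Function.update_of_ne hp _ _
      have hjl : (j l : ℕ) = i l - 1 := by simp [j]
      have hsum := sum_val_of_eq_off hj
      rw [← hF j i l h (fun p hp => (hj p hp).symm) (by omega) (by omega) (by omega)]
      exact ih _ (sum_natAbs_lt_of_eq_off hj (by omega)) (by omega) (by omega) (by omega) rfl
    have hle : (∀ l, (i l : ℤ) ≤ i' l) ∨ ∀ l, (i' l : ℤ) ≤ i l := by
      by_contra! hc
      obtain ⟨⟨p, hp⟩, q, hq⟩ := hc
      refine hup ⟨⟨q, by omega⟩, ?_⟩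
      by_contra hh
      exact hdown ⟨⟨p, by omega⟩, by omega⟩
    have heq : i = i' := by
      by_contra hne
      obtain ⟨l, hl⟩ := Function.ne_iff.mp hne
      have hl' : (i l : ℕ) ≠ i' l := fun e => hl (Fin.ext e)
      rcases hle with hle | hle
      · have hlt : (i l : ℤ) < i' l := lt_of_le_of_ne (hle l) (by omega)
        have := Finset.sum_lt_sum (fun l _ => hle l) ⟨l, Finset.mem_univ l, hlt⟩
        exact hup ⟨⟨l, by omega⟩, by omega⟩
      · have hlt : (i' l : ℤ) < i l := lt_of_le_of_ne (hle l) (by omega)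
        have := Finset.sum_lt_sum (fun l _ => hle l) ⟨l, Finset.mem_univ l, hlt⟩
        exact hdown ⟨⟨l, by omega⟩, by omega⟩
    subst heq
    rw [add_left_cancel hs]

/-- A Hankel function which vanishes whenever two given entries agree is zero. -/
theorem IsHankel.eq_zero {k : Type*} [Zero k] {a n : ℕ} {F : (Fin n → Fin (a + 1)) → ℤ → k}
    (hF : IsHankel a F) (ha : 3 ≤ a) {p q : Fin n} (hpq : p ≠ q)
    (hzero : ∀ i h, i p = i q → F i h = 0) (i : Fin n → Fin (a + 1)) {h : ℤ}
    (h1 : 1 ≤ h) (h2 : h + 1 ≤ a) : F i h = 0 := by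
  obtain ⟨u, h', hu, h1', h2', hs⟩ : ∃ (u : ℕ) (h' : ℤ), u < a + 1 ∧ 1 ≤ h' ∧ h' + 1 ≤ a ∧
      (i p : ℤ) + i q + h = 2 * u + h' := by
    have := (i p).2
    have := (i q).2
    rcases Nat.even_or_odd' ((i p : ℕ) + i q) with ⟨u, hu | hu⟩
    · exact ⟨u, h, by omega, h1, h2, by omega⟩
    · by_cases hh : h + 2 ≤ a
      · exact ⟨u, h + 1, by omega, by omega, by omega, by omega⟩
      · exact ⟨u + 1, h - 1, by omega, by omega, by omega, by omega⟩
  let j := Function.update i p ⟨u, hu⟩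
  let j' := Function.update j q ⟨u, hu⟩
  have e := sum_val_of_eq_off (i := i) (i' := j) (l := p) fun l hl => Function.update_of_ne hl _ _
  have e' := sum_val_of_eq_off (i := j) (i' := j') (l := q) fun l hl => Function.update_of_ne hl _ _
  have ejp : (j p : ℤ) = u := by simp [j]
  have ejq : (j q : ℤ) = i q := by simp [j, hpq.symm]
  have ejq' : (j' q : ℤ) = u := by simp [j']
  rw [hF.eq_of_sum_eq ha h1 h2 h1' h2' (i' := j') (by omega)]
  exact hzero _ _ (by simp [j', j, hpq])

end Tuples

section Kernel

variable {k : Type*} [Field k]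

theorem skipAt_succ {n : ℕ} (l : Fin (n + 1)) (t : Fin n) :
    skipAt (m := n + 1) l t = l.succAbove t := by
  ext
  simp only [skipAt, Fin.succAbove, Fin.lt_def, Fin.val_castSucc]
  split <;> simp

theorem vB_castSucc (a b : ℕ) (j : Fin a) (r : Fin b) :
    vB k a b (j.castSucc, r) = Pi.single (j, r) 1 := by
  simp [vB]

theorem vB_last (a b : ℕ) (r : Fin b) : vB k a b (Fin.last a, r) = 0 := by
  simp [vB]

theorem vBshift_succ (a b : ℕ) (j : Fin a) (r : Fin b) :
    vBshift k a b (j.succ, r) = Pi.single (j, r) 1 := by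
  simp [vBshift]

theorem vBshift_zero (a b : ℕ) (r : Fin b) : vBshift k a b (0, r) = 0 := by
  simp [vBshift]

theorem vB_apply (a b : ℕ) (P : Fin (a + 1) × Fin b) (j : Fin a) (r : Fin b) :
    vB k a b P (j, r) = if (j.castSucc, r) = P then 1 else 0 := by
  obtain ⟨p, s⟩ := P
  induction p using Fin.lastCases with
  | last => simp [vB_last, Fin.ext_iff, j.2.ne]
  | cast p => simp [vB_castSucc, Pi.single_apply]

theorem vBshift_apply (a b : ℕ) (P : Fin (a + 1) × Fin b) (j : Fin a) (r : Fin b) :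
    vBshift k a b P (j, r) = if (j.succ, r) = P then 1 else 0 := by
  obtain ⟨p, s⟩ := P
  induction p using Fin.cases with
  | zero => simp [vBshift_zero]
  | succ p => simp [vBshift_succ, Pi.single_apply]

/-- Expansion of the coordinates of a wedge product along the first factor of the dual form. -/
theorem wedgeCoord_cons_wedge {ι : Type*} [DecidableEq ι] {n : ℕ} (p : ι) (Q : Fin n → ι)
    (P : Fin (n + 1) → ι) :
    wedgeCoord k (Fin.cons p Q : Fin (n + 1) → ι) (wedge k (n + 1) (fun l => Pi.single (P l) 1)) =
      ∑ l : Fin (n + 1), (-1) ^ (l : ℕ) * (if p = P l then 1 else 0) *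
        wedgeCoord k Q (wedge k n (fun t => Pi.single (P (l.succAbove t)) 1)) := by
  rw [wedgeCoord_wedge, Matrix.det_succ_column_zero]
  refine Finset.sum_congr rfl fun l _ => ?_
  rw [wedgeCoord_wedge Q (fun t => P (l.succAbove t))]
  rfl

variable {a n : ℕ}
  {f : ((⋀[k]^(n + 1) ((Fin (a + 1) × Fin (n + 1)) → k)) ⊗[k] (Fin (a - 1) → k)) →ₗ[k]
    (((⋀[k]^n ((Fin (a + 1) × Fin (n + 1)) → k)) ⊗[k] (Fin a × Fin (n + 1) → k)) ⊗[k]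
      (Fin (a - 2) → k))}

theorem IsTheMapF.apply_wedge (hf : IsTheMapF k a (n + 1) f)
    (P : Fin (n + 1) → Fin (a + 1) × Fin (n + 1)) (h : ℤ) :
    f (wedge k (n + 1) (fun l => Pi.single (P l) 1) ⊗ₜ[k] gG k (a - 1) h) =
      ∑ l : Fin (n + 1), ((-1 : k) ^ ((l : ℕ) + 1)) •
        (((wedge k n (fun t => Pi.single (P (l.succAbove t)) 1) ⊗ₜ[k] vB k a (n + 1) (P l))
            ⊗ₜ[k] gG k (a - 2) (h - 1))
          - ((wedge k n (fun t => Pi.single (P (l.succAbove t)) 1) ⊗ₜ[k] vBshift k a (n + 1) (P l))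
            ⊗ₜ[k] gG k (a - 2) h)) := by
  simp only [← skipAt_succ]
  exact hf P h

theorem IsTheMapF.wedgeGCoeff_cons (hf : IsTheMapF k a (n + 1) f)
    (Q : Fin n → Fin (a + 1) × Fin (n + 1)) (j : Fin a) (r : Fin (n + 1)) {m : ℤ}
    (h1 : 1 ≤ m) (h2 : m + 2 ≤ a)
    {x : (⋀[k]^(n + 1) ((Fin (a + 1) × Fin (n + 1)) → k)) ⊗[k] (Fin (a - 1) → k)} (hx : f x = 0) :
    wedgeGCoeff k (a - 1) (Fin.cons (j.castSucc, r) Q) (m + 1) x =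
      wedgeGCoeff k (a - 1) (Fin.cons (j.succ, r) Q) m x := by
  let φ : (((⋀[k]^n ((Fin (a + 1) × Fin (n + 1)) → k)) ⊗[k] (Fin a × Fin (n + 1) → k)) ⊗[k]
      (Fin (a - 2) → k)) →ₗ[k] k :=
    LinearMap.mul' k k ∘ₗ TensorProduct.map
      (LinearMap.mul' k k ∘ₗ TensorProduct.map (wedgeCoord k Q) (LinearMap.proj (j, r)))
      (gCoord k (a - 2) m)
  have hφ (w v g) : φ ((w ⊗ₜ v) ⊗ₜ g) = wedgeCoord k Q w * v (j, r) * gCoord k (a - 2) m g := rfl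
  have key : φ ∘ₗ f = wedgeGCoeff k (a - 1) (Fin.cons (j.succ, r) Q) m -
      wedgeGCoeff k (a - 1) (Fin.cons (j.castSucc, r) Q) (m + 1) := by
    refine linearMap_ext_wedge_tmul_gG fun P h => ?_
    rw [LinearMap.comp_apply, hf.apply_wedge, LinearMap.sub_apply, wedgeGCoeff_tmul,
      wedgeGCoeff_tmul, wedgeCoord_cons_wedge, wedgeCoord_cons_wedge, map_sum, Finset.sum_mul,
      Finset.sum_mul, ← Finset.sum_sub_distrib]
    refine Finset.sum_congr rfl fun l _ => ?_
    rw [map_smul, map_sub, hφ, hφ, vB_apply, vBshift_apply]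
    have e1 : gCoord k (a - 1) m (gG k (a - 1) h) = gCoord k (a - 2) m (gG k (a - 2) h) := by
      rw [gCoord_gG, gCoord_gG]
      congr 1
      simp only [eq_iff_iff]
      omega
    have e2 : gCoord k (a - 1) (m + 1) (gG k (a - 1) h) =
        gCoord k (a - 2) m (gG k (a - 2) (h - 1)) := by
      rw [gCoord_gG, gCoord_gG]
      congr 1
      simp only [eq_iff_iff]
      omega
    rw [e1, e2, smul_eq_mul]
    ring
  have := LinearMap.congr_fun key x
  rw [LinearMap.comp_apply, hx, map_zero, LinearMap.sub_apply] at this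
  exact (sub_eq_zero.mp this.symm).symm

/-- The coefficients of an element of `ker f` along tuples of points with fixed second
coordinates form a Hankel function. -/
theorem IsTheMapF.isHankel (hf : IsTheMapF k a (n + 1) f)
    {x : (⋀[k]^(n + 1) ((Fin (a + 1) × Fin (n + 1)) → k)) ⊗[k] (Fin (a - 1) → k)} (hx : f x = 0)
    (r : Fin (n + 1) → Fin (n + 1)) :
    IsHankel a (fun i h => wedgeGCoeff k (a - 1) (fun l => (i l, r l)) h x) := by
  intro i i' l m hi hl h1 h2
  let σ : Equiv.Perm (Fin (n + 1)) := Equiv.swap 0 l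
  have hla : (i l : ℕ) < a := by have := (i' l).2; omega
  let j : Fin a := ⟨i l, hla⟩
  have hσ (t : Fin n) : σ t.succ ≠ l := by
    rw [← Equiv.swap_apply_left 0 l]
    exact fun e => Fin.succ_ne_zero t (σ.injective e)
  have e1 : (fun p => (i p, r p)) ∘ σ =
      Fin.cons (j.castSucc, r l) (fun t => (i (σ t.succ), r (σ t.succ))) := by
    funext t
    refine Fin.cases ?_ (fun t => ?_) t
    · simp [σ, j]
    · simp
  have e2 : (fun p => (i' p, r p)) ∘ σ =
      Fin.cons (j.succ, r l) (fun t => (i (σ t.succ), r (σ t.succ))) := by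
    funext t
    refine Fin.cases ?_ (fun t => ?_) t
    · simp [σ, j, Fin.ext_iff, hl]
    · simp [hi _ (hσ t)]
  have key := hf.wedgeGCoeff_cons (fun t => (i (σ t.succ), r (σ t.succ))) j (r l) h1 h2 hx
  rw [← e1, ← e2, wedgeGCoeff_comp_perm, wedgeGCoeff_comp_perm] at key
  rcases Int.units_eq_one_or (Equiv.Perm.sign σ) with hs | hs <;> simpa [hs] using key

theorem IsTheMapF.xker_mem_ker (hf : IsTheMapF k a (n + 1) f) (h : ℤ) :
    f (xker k a (n + 1) h) = 0 := by
  rw [xker, map_sum]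
  simp only [hf.apply_wedge]
  rw [Finset.sum_comm]
  refine Finset.sum_eq_zero fun l _ => ?_
  rw [← Finset.smul_sum, ← (Fin.insertNthEquiv (fun _ => Fin (a + 1)) l).sum_comp,
    Fintype.sum_prod_type_right]
  refine smul_eq_zero_of_right _ (Finset.sum_eq_zero fun i _ => ?_)
  simp only [Fin.insertNthEquiv_apply, Fin.insertNth_apply_same, Fin.insertNth_apply_succAbove,
    Fin.sum_univ_succAbove _ l, Finset.sum_sub_distrib]
  rw [sub_eq_zero, Fin.sum_univ_castSucc, Fin.sum_univ_succ (n := a)]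
  simp only [vB_last, vBshift_zero, TensorProduct.tmul_zero, TensorProduct.zero_tmul, add_zero,
    zero_add, vB_castSucc, vBshift_succ]
  refine Finset.sum_congr rfl fun j _ => ?_
  congr 2
  simp only [Fin.val_castSucc, Fin.val_succ]
  push_cast
  ring

theorem wedgeGCoeff_xker_of_not_surjective {b : ℕ} (P : Fin b → Fin (a + 1) × Fin b)
    (hP : ¬ Function.Surjective fun l => (P l).2) (h s : ℤ) :
    wedgeGCoeff k (a - 1) P h (xker k a b s) = 0 := by
  simp only [Function.Surjective, not_forall, not_exists] at hP
  obtain ⟨l, hl⟩ := hP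
  rw [xker, map_sum]
  refine Finset.sum_eq_zero fun i _ => ?_
  rw [wedgeGCoeff_tmul, wedgeCoord_wedge P (fun l => (i l, l)),
    Matrix.det_eq_zero_of_row_eq_zero l, zero_mul]
  intro j
  simp only [Matrix.of_apply, ite_eq_right_iff, one_ne_zero, imp_false]
  exact fun e => hl j (congrArg Prod.snd e)

theorem wedgeGCoeff_xker {b : ℕ} (i : Fin b → Fin (a + 1)) {h : ℤ} (h1 : 1 ≤ h)
    (h2 : h + 1 ≤ a) (s : ℤ) :
    wedgeGCoeff k (a - 1) (fun l => (i l, l)) h (xker k a b s) =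
      if ∑ l, (i l : ℤ) + h = s then 1 else 0 := by
  rw [xker, map_sum, Finset.sum_eq_single i]
  · rw [wedgeGCoeff_tmul, wedgeCoord_wedge (fun l => (i l, l)) (fun l => (i l, l)), gCoord_gG]
    have : (Matrix.of fun p q : Fin b => if (i q, q) = (i p, p) then (1 : k) else 0) = 1 := by
      ext p q
      by_cases hpq : p = q
      · subst hpq; simp [Matrix.one_apply_eq]
      · simp [hpq, Ne.symm hpq]
    rw [this, Matrix.det_one, one_mul]
    congr 1
    simp only [eq_iff_iff]
    omega
  · intro i' _ hne
    obtain ⟨l, hl⟩ := Function.ne_iff.mp hne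
    rw [wedgeGCoeff_tmul, wedgeCoord_wedge (fun l => (i l, l)) (fun l => (i' l, l)),
      Matrix.det_eq_zero_of_row_eq_zero l, zero_mul]
    intro j
    simp only [Matrix.of_apply, ite_eq_right_iff, one_ne_zero, imp_false, Prod.mk.injEq]
    rintro ⟨e, rfl⟩
    exact hl e.symm
  · simp

theorem exists_sum_add_eq {b : ℕ} (ha : 3 ≤ a) (t : Fin (a * (b + 1) - 1)) :
    ∃ (i : Fin b → Fin (a + 1)) (h : ℤ), 1 ≤ h ∧ h + 1 ≤ a ∧
      ∑ l, (i l : ℤ) + h = ((t : ℕ) + 1 : ℤ) := by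
  have ht : (t : ℕ) < a * b + a - 1 := mul_add_one a b ▸ t.2
  by_cases hle : (t : ℕ) ≤ a * b
  · obtain ⟨i, hi⟩ := exists_sum_val_eq a b t hle
    exact ⟨i, 1, le_rfl, by omega, by rw [hi]⟩
  · obtain ⟨i, hi⟩ := exists_sum_val_eq a b (a * b) le_rfl
    exact ⟨i, (t : ℕ) + 1 - (a * b : ℕ), by omega, by omega, by rw [hi]; ring⟩

theorem linearIndependent_xker (b : ℕ) (ha : 3 ≤ a) :
    LinearIndependent k (fun t : Fin (a * (b + 1) - 1) => xker k a b ((t : ℕ) + 1 : ℤ)) := by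
  choose i h h1 h2 hs using exists_sum_add_eq (a := a) (b := b) ha
  refine LinearIndependent.of_pairwise_dual_eq_zero_one _
    (fun t => wedgeGCoeff k (a - 1) (fun l => (i t l, l)) (h t)) (fun s t hst => ?_) (fun t => ?_)
  · beta_reduce
    rw [wedgeGCoeff_xker _ (h1 s) (h2 s), hs, if_neg]
    have := Fin.val_ne_of_ne hst
    omega
  · rw [wedgeGCoeff_xker _ (h1 t) (h2 t), hs, if_pos rfl]

theorem IsTheMapF.mem_span_xker (hf : IsTheMapF k a (n + 1) f) (ha : 3 ≤ a)
    {x : (⋀[k]^(n + 1) ((Fin (a + 1) × Fin (n + 1)) → k)) ⊗[k] (Fin (a - 1) → k)}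
    (hx : f x = 0) :
    x ∈ Submodule.span k (Set.range
      (fun t : Fin (a * (n + 1 + 1) - 1) => xker k a (n + 1) ((t : ℕ) + 1 : ℤ))) := by
  choose i h h1 h2 hs using exists_sum_add_eq (a := a) (b := n + 1) ha
  rw [Submodule.mem_span_range_iff_exists_fun]
  refine ⟨fun t => wedgeGCoeff k (a - 1) (fun l => (i t l, l)) (h t) x, ?_⟩
  refine ext_wedgeGCoeff fun P d hd1 hd2 => ?_
  have hd2' : d + 1 ≤ a := by omega
  simp only [map_sum, map_smul, smul_eq_mul]
  by_cases hP : Function.Injective fun l => (P l).2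
  · let σ := Equiv.ofBijective _ (Finite.injective_iff_bijective.mp hP)
    let j : Fin (n + 1) → Fin (a + 1) := fun l => (P (σ.symm l)).1
    have hPσ : P = (fun l => (j l, l)) ∘ σ := by
      funext l
      refine Prod.ext ?_ rfl
      simp [j]
    simp only [hPσ, wedgeGCoeff_comp_perm, mul_smul_comm, ← Finset.smul_sum]
    congr 1
    simp only [wedgeGCoeff_xker j hd1 hd2', mul_ite, mul_one, mul_zero]
    have hj0 : 0 ≤ ∑ l, (j l : ℤ) := Finset.sum_nonneg fun l _ => by positivity
    have hja : ∑ l, (j l : ℤ) ≤ (a * (n + 1) : ℕ) := by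
      calc ∑ l, (j l : ℤ) ≤ ∑ _l : Fin (n + 1), (a : ℤ) :=
            Finset.sum_le_sum fun l _ => by have := (j l).2; omega
        _ = (a * (n + 1) : ℕ) := by simp [mul_comm]
    have hlt : (∑ l, (j l : ℤ) + d - 1).toNat < a * (n + 1 + 1) - 1 := by
      rw [mul_add a (n + 1) 1, mul_one]
      omega
    rw [Finset.sum_eq_single ⟨(∑ l, (j l : ℤ) + d - 1).toNat, hlt⟩]
    · rw [if_pos (by simp only; omega)]
      refine (hf.isHankel hx id).eq_of_sum_eq ha (h1 _) (h2 _) hd1 hd2' ?_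
      rw [hs]
      simp only
      omega
    · intro t _ ht
      rw [if_neg]
      intro e
      refine ht (Fin.ext ?_)
      simp only
      omega
    · simp
  · have hP' : ¬ Function.Surjective fun l => (P l).2 :=
      fun e => hP (Finite.injective_iff_surjective.mpr e)
    simp only [wedgeGCoeff_xker_of_not_surjective P hP', mul_zero, Finset.sum_const_zero]
    simp only [Function.Injective, not_forall] at hP
    obtain ⟨p, q, hpq, hne⟩ := hP
    refine ((hf.isHankel hx fun l => (P l).2).eq_zero ha hne (fun i d hi => ?_)
      (fun l => (P l).1) hd1 hd2').symm
    rw [wedgeGCoeff_eq_zero (fun l => (i l, (P l).2)) hne (Prod.ext hi hpq), LinearMap.zero_apply]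

end Kernel

/-- The elements `x_h` for `h = 1, …, a(b+1)−1` form a basis of `ker f`:
they are linearly independent and span `ker f`.  In particular
`dim_k ker f = a(b+1) − 1`. -/
theorem xker_basis_of_ker (k : Type*) [Field k] (a b : ℕ) (ha : 3 ≤ a) (hab : a ≤ b)
    (f : ((⋀[k]^b ((Fin (a + 1) × Fin b) → k)) ⊗[k] (Fin (a - 1) → k)) →ₗ[k]
      (((⋀[k]^(b - 1) ((Fin (a + 1) × Fin b) → k)) ⊗[k] (Fin a × Fin b → k)) ⊗[k]
        (Fin (a - 2) → k)))
    (hf : IsTheMapF k a b f) :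
    LinearIndependent k (fun t : Fin (a * (b + 1) - 1) => xker k a b ((t : ℕ) + 1 : ℤ)) ∧
    Submodule.span k (Set.range (fun t : Fin (a * (b + 1) - 1) => xker k a b ((t : ℕ) + 1 : ℤ)))
      = LinearMap.ker f ∧
    Module.finrank k (LinearMap.ker f) = a * (b + 1) - 1 := by
  obtain ⟨n, rfl⟩ : ∃ n, b = n + 1 := ⟨b - 1, by omega⟩
  have hli := linearIndependent_xker (k := k) (n + 1) ha
  have hspan : Submodule.span k (Set.range
      (fun t : Fin (a * (n + 1 + 1) - 1) => xker k a (n + 1) ((t : ℕ) + 1 : ℤ))) =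
        LinearMap.ker f := by
    refine le_antisymm (Submodule.span_le.mpr ?_) fun x hx => IsTheMapF.mem_span_xker hf ha hx
    rintro _ ⟨t, rfl⟩
    exact IsTheMapF.xker_mem_ker hf _
  refine ⟨hli, hspan, ?_⟩
  rw [← hspan, finrank_span_eq_card hli, Fintype.card_fin]

end
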